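/- arXiv:0903.5122 — 5 statements merged into one kernel-verified Lean document; each statement's English description precedes it below -/
import Mathlib

section
/- For any n-player normal-form game with strictly positive utilities, and for any choice of selfishness levels α_1, …, α_n, one per player, with each α_i ≥ 0, there exists a strategy profile p* such that for every player i and every x_i ∈ S_i, p*_i(x_i) = u_i(x_i, p*_{-i})^{α_i} / Σ_{y_i ∈ S_i} u_i(y_i, p*_{-i})^{α_i}. In particular, taking all α_i equal to a common value α ≥ 0, a generalized equilibrium at selfishness level α exists for every such game. -/
open Finset

/-- `p` is a (mixed) strategy profile: each `p i` is a probability distribution on `S i`. -/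
def IsProfile {n : ℕ} {S : Fin n → Type*} [∀ i, Fintype (S i)]
    (p : ∀ i, S i → ℝ) : Prop :=
  (∀ i a, 0 ≤ p i a) ∧ ∀ i, ∑ a, p i a = 1

/-- The action payoff `u_i(a, p_{-i})` of action `a` of player `i` against profile `p`. -/
noncomputable def actionPayoff {n : ℕ} {S : Fin n → Type*} [∀ i, Fintype (S i)]
    [∀ i, DecidableEq (S i)]
    (u : ∀ _ : Fin n, (∀ j, S j) → ℝ) (p : ∀ i, S i → ℝ) (i : Fin n) (a : S i) : ℝ :=
  ∑ x : ∀ j, S j, if x i = a then u i x * ∏ j ∈ univ.erase i, p j (x j) else 0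

/-! ### A mod 2 cochain argument on the Freudenthal triangulation of the grid -/

/-- The `k`-th vertex of the Freudenthal simplex with base point `z` whose coordinate `j` is
incremented at step `σ j`. -/
def simplexVertex {n : ℕ} (z : Fin n → ℕ) (σ : Equiv.Perm (Fin n)) (k : ℕ) : Fin n → ℕ :=
  fun j => z j + if (σ j : ℕ) < k then 1 else 0

/-- The grid points with all coordinates less than `m`. -/
abbrev gridBox (n m : ℕ) : Finset (Fin n → ℕ) := Fintype.piFinset fun _ => range m

/-- The cup product of the coboundaries of the `l j`, evaluated on the sum of all Freudenthal
simplices of the grid of side `m`. -/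
def gridDegree {n : ℕ} (m : ℕ) (l : Fin n → (Fin n → ℕ) → ZMod 2) : ZMod 2 :=
  ∑ z ∈ gridBox n m, ∑ σ : Equiv.Perm (Fin n),
    ∏ j, (l j (simplexVertex z σ (j + 1)) - l j (simplexVertex z σ j))

/-- The product of the value of `l i` at vertex `c` and of the increments of `l j`, `j ≠ i`, along
the edges from vertex `s j` to vertex `s j + 1`. -/
def shiftedProduct {n : ℕ} (l : Fin n → (Fin n → ℕ) → ZMod 2) (i : Fin n) (s : Fin n → ℕ) (c : ℕ)
    (v : ℕ → Fin n → ℕ) : ZMod 2 :=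
  (∏ j ∈ univ.erase i, (l j (v (s j + 1)) - l j (v (s j)))) * l i (v c)

lemma shiftedProduct_congr {n : ℕ} {l : Fin n → (Fin n → ℕ) → ZMod 2} {i : Fin n}
    {s s' : Fin n → ℕ} {c c' : ℕ} {v v' : ℕ → Fin n → ℕ} (hc : v c = v' c')
    (h : ∀ j ≠ i, v (s j) = v' (s' j) ∧ v (s j + 1) = v' (s' j + 1)) :
    shiftedProduct l i s c v = shiftedProduct l i s' c' v' := by
  unfold shiftedProduct
  rw [hc]
  congr 1
  refine prod_congr rfl fun j hj => ?_
  rw [(h j (ne_of_mem_erase hj)).1, (h j (ne_of_mem_erase hj)).2]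

lemma simplexVertex_swap {n : ℕ} (z : Fin n → ℕ) (σ : Equiv.Perm (Fin n)) {k t : ℕ}
    (hk : k + 1 < n) (ht : t ≠ k + 1) :
    simplexVertex z (Equiv.swap ⟨k, by omega⟩ ⟨k + 1, hk⟩ * σ) t = simplexVertex z σ t := by
  funext j
  unfold simplexVertex
  congr 1
  rw [Equiv.Perm.mul_apply, Equiv.swap_apply_def]
  have h0 : σ j = ⟨k, by omega⟩ ↔ (σ j : ℕ) = k := by rw [Fin.ext_iff]
  have h1 : σ j = ⟨k + 1, hk⟩ ↔ (σ j : ℕ) = k + 1 := by rw [Fin.ext_iff]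
  simp only [h0, h1]
  split_ifs <;> simp_all <;> omega

/-- A function of the simplices that ignores an intermediate vertex sums to zero, as the simplices
sharing the opposite facet come in pairs. -/
lemma sum_perm_eq_zero_of_swap_invariant {n k : ℕ} (hk : k + 1 < n)
    (f : Equiv.Perm (Fin n) → ZMod 2)
    (hf : ∀ σ, f (Equiv.swap ⟨k, by omega⟩ ⟨k + 1, hk⟩ * σ) = f σ) : ∑ σ, f σ = 0 := by
  refine Finset.sum_involution (fun σ _ => Equiv.swap ⟨k, by omega⟩ ⟨k + 1, hk⟩ * σ)
    (fun σ _ => ?_) (fun σ _ _ h => ?_) (fun _ _ => mem_univ _) (fun σ _ => ?_)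
  · rw [hf, CharTwo.add_self_eq_zero]
  · have := mul_eq_right.1 h
    rw [Equiv.swap_eq_one_iff, Fin.ext_iff] at this
    simp at this
  · rw [← mul_assoc, Equiv.swap_mul_self, one_mul]

lemma sum_shiftedProduct_update {n : ℕ} (l : Fin n → (Fin n → ℕ) → ZMod 2) (i : Fin n)
    (s : Fin n → ℕ) (c : ℕ) (z : Fin n → ℕ) (j₀ : Fin n) (hj₀ : j₀ ≠ i) (hk : s j₀ + 1 < n)
    (hc : c ≠ s j₀ + 1)
    (hs : ∀ j, j ≠ i → j ≠ j₀ → s j ≠ s j₀ + 1 ∧ s j ≠ s j₀) :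
    ∑ σ, shiftedProduct l i s c (simplexVertex z σ) =
      ∑ σ, shiftedProduct l i (Function.update s j₀ (s j₀ + 1)) c (simplexVertex z σ) := by
  rw [← CharTwo.add_eq_zero, ← sum_add_distrib]
  have key : ∀ σ, shiftedProduct l i s c (simplexVertex z σ) +
      shiftedProduct l i (Function.update s j₀ (s j₀ + 1)) c (simplexVertex z σ) =
      (∏ j ∈ (univ.erase i).erase j₀,
        (l j (simplexVertex z σ (s j + 1)) - l j (simplexVertex z σ (s j)))) *
      ((l j₀ (simplexVertex z σ (s j₀ + 2)) - l j₀ (simplexVertex z σ (s j₀))) *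
        l i (simplexVertex z σ c)) := by
    intro σ
    have hm : j₀ ∈ univ.erase i := mem_erase.2 ⟨hj₀, mem_univ _⟩
    unfold shiftedProduct
    rw [← mul_prod_erase _ _ hm, ← mul_prod_erase _ _ hm]
    have : ∏ j ∈ (univ.erase i).erase j₀,
        (l j (simplexVertex z σ (Function.update s j₀ (s j₀ + 1) j + 1)) -
          l j (simplexVertex z σ (Function.update s j₀ (s j₀ + 1) j))) =
        ∏ j ∈ (univ.erase i).erase j₀,
        (l j (simplexVertex z σ (s j + 1)) - l j (simplexVertex z σ (s j))) :=
      prod_congr rfl fun j hj => by rw [Function.update_of_ne (ne_of_mem_erase hj)]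
    rw [this, Function.update_self]
    ring
  refine sum_perm_eq_zero_of_swap_invariant hk _ fun σ => ?_
  rw [key, key, simplexVertex_swap z σ hk hc, simplexVertex_swap z σ hk (by omega),
    simplexVertex_swap z σ hk (by omega)]
  congr 1
  refine prod_congr rfl fun j hj => ?_
  obtain ⟨h1, h2⟩ := hs j (ne_of_mem_erase (mem_of_mem_erase hj)) (ne_of_mem_erase hj)
  rw [simplexVertex_swap z σ hk (by omega), simplexVertex_swap z σ hk h1]

lemma sum_shiftedProduct_raise {n : ℕ} (l : Fin n → (Fin n → ℕ) → ZMod 2) (i : Fin n)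
    (z : Fin n → ℕ) :
    ∑ σ, shiftedProduct l i (fun j => j) (i + 1) (simplexVertex z σ) =
      ∑ σ, shiftedProduct l i (fun j => if j < i then j + 1 else j) (i + 1)
        (simplexVertex z σ) := by
  have key : ∀ d : ℕ, d ≤ i →
      ∑ σ, shiftedProduct l i (fun j => j) (i + 1) (simplexVertex z σ) =
      ∑ σ, shiftedProduct l i (fun j => if (i : ℕ) ≤ j + d ∧ j < i then j + 1 else j) (i + 1)
        (simplexVertex z σ) := by
    intro d
    induction d with
    | zero =>
      intro _
      refine sum_congr rfl fun σ _ => shiftedProduct_congr rfl fun j hj => ?_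
      rw [if_neg (by rw [Fin.lt_def]; omega)]
      exact ⟨rfl, rfl⟩
    | succ d ih =>
      intro hd
      have hi := i.2
      rw [ih (by omega), sum_shiftedProduct_update l i _ _ z ⟨i - (d + 1), by omega⟩]
      · refine sum_congr rfl fun σ _ => shiftedProduct_congr rfl fun j hj => ?_
        suffices h : (Function.update (fun j : Fin n => if (i : ℕ) ≤ j + d ∧ j < i then (j : ℕ) + 1
            else j) ⟨i - (d + 1), by omega⟩ ((if (i : ℕ) ≤ (i - (d + 1)) + d ∧
              (⟨i - (d + 1), by omega⟩ : Fin n) < i then (i - (d + 1)) + 1 else i - (d + 1)) + 1)) j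
            = if (i : ℕ) ≤ j + (d + 1) ∧ j < i then (j : ℕ) + 1 else j by
          rw [← h]; exact ⟨rfl, rfl⟩
        rw [Function.update_apply]
        simp only [Fin.ext_iff, Fin.lt_def]
        split_ifs <;> omega
      all_goals simp only [ne_eq, Fin.ext_iff, Fin.lt_def]
      · omega
      · split_ifs <;> omega
      · split_ifs <;> omega
      · intro j h1 h2
        split_ifs <;> omega
  rw [key i le_rfl]
  refine sum_congr rfl fun σ _ => shiftedProduct_congr rfl fun j hj => ?_
  simp

lemma sum_shiftedProduct_lower {n : ℕ} (l : Fin n → (Fin n → ℕ) → ZMod 2) (i : Fin n)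
    (z : Fin n → ℕ) :
    ∑ σ, shiftedProduct l i (fun j => j) i (simplexVertex z σ) =
      ∑ σ, shiftedProduct l i (fun j => if j < i then j else j - 1) i
        (simplexVertex z σ) := by
  have key : ∀ d : ℕ, i + d < n →
      ∑ σ, shiftedProduct l i (fun j => j) i (simplexVertex z σ) =
      ∑ σ, shiftedProduct l i (fun j => if i < j ∧ (j : ℕ) ≤ i + d then j - 1 else j) i
        (simplexVertex z σ) := by
    intro d
    induction d with
    | zero =>
      intro _
      refine sum_congr rfl fun σ _ => shiftedProduct_congr rfl fun j hj => ?_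
      rw [if_neg (by rw [Fin.lt_def]; omega)]
      exact ⟨rfl, rfl⟩
    | succ d ih =>
      intro hd
      rw [ih (by omega)]
      symm
      rw [sum_shiftedProduct_update l i _ _ z ⟨i + (d + 1), hd⟩]
      · refine sum_congr rfl fun σ _ => shiftedProduct_congr rfl fun j hj => ?_
        suffices h : (Function.update (fun j : Fin n => if i < j ∧ (j : ℕ) ≤ i + (d + 1) then
            (j : ℕ) - 1 else j) ⟨i + (d + 1), hd⟩ ((if i < (⟨i + (d + 1), hd⟩ : Fin n) ∧
              (i + (d + 1) : ℕ) ≤ i + (d + 1) then (i + (d + 1) : ℕ) - 1 else i + (d + 1)) + 1)) j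
            = if i < j ∧ (j : ℕ) ≤ i + d then (j : ℕ) - 1 else j by
          rw [← h]; exact ⟨rfl, rfl⟩
        rw [Function.update_apply]
        simp only [Fin.ext_iff, Fin.lt_def]
        split_ifs <;> omega
      all_goals simp only [ne_eq, Fin.ext_iff, Fin.lt_def]
      · omega
      · split_ifs <;> omega
      · split_ifs <;> omega
      · intro j h1 h2
        split_ifs <;> omega
  have hi := i.2
  rw [key (n - 1 - i) (by omega)]
  refine sum_congr rfl fun σ _ => shiftedProduct_congr rfl fun j hj => ?_
  have hj' : (j : ℕ) ≠ i := fun h => hj (Fin.ext h)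
  suffices h : (if i < j ∧ (j : ℕ) ≤ i + (n - 1 - i) then (j : ℕ) - 1 else j) =
      if j < i then (j : ℕ) else j - 1 by rw [h]; exact ⟨rfl, rfl⟩
  simp only [Fin.lt_def]
  split_ifs <;> omega

lemma sum_gridBox_add_single {n m : ℕ} (g : (Fin n → ℕ) → ZMod 2) (j : Fin n)
    (hg : ∀ z, z j = 0 ∨ z j = m → g z = 0) :
    ∑ z ∈ gridBox n m, g (z + Pi.single j 1) = ∑ z ∈ gridBox n m, g z := by
  refine Finset.sum_bij_ne_zero (fun z _ _ => z + Pi.single j 1) ?_ ?_ ?_ ?_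
  · intro z hz hne
    simp only [Fintype.mem_piFinset, mem_range] at hz ⊢
    intro a
    by_cases ha : a = j
    · subst ha
      have : z a + 1 ≠ m := fun h => hne (hg _ (Or.inr (by simpa using h)))
      have := hz a
      simp
      omega
    · simpa [ha] using hz a
  · intro z _ _ z' _ _ h
    exact add_right_cancel h
  · intro z hz hne
    have h0 : z j ≠ 0 := fun h => hne (hg _ (Or.inl h))
    have hzz : z - Pi.single j 1 + Pi.single j 1 = z := by
      funext a
      by_cases ha : a = j
      · subst ha
        simp
        omega
      · simp [ha]
    refine ⟨z - Pi.single j 1, ?_, by rwa [hzz], hzz⟩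
    simp only [Fintype.mem_piFinset, mem_range] at hz ⊢
    intro a
    exact lt_of_le_of_lt (Nat.sub_le _ _) (hz a)
  · intros
    rfl

lemma simplexVertex_finRotate {n : ℕ} (z : Fin (n + 1) → ℕ) (σ : Equiv.Perm (Fin (n + 1)))
    {k : ℕ} (hk : k ≤ n) :
    simplexVertex z (finRotate (n + 1) * σ) (k + 1) =
      simplexVertex (z + Pi.single (σ.symm (Fin.last n)) 1) σ k := by
  funext j
  unfold simplexVertex
  rw [Equiv.Perm.mul_apply, Pi.add_apply]
  by_cases hj : j = σ.symm (Fin.last n)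
  · subst hj
    simp [hk]
  · have h : σ j ≠ Fin.last n := fun h => hj (by rw [← h, Equiv.symm_apply_apply])
    rw [coe_finRotate_of_ne_last h]
    simp [hj]

/-- The degree vanishes if `l i` vanishes on the two faces orthogonal to direction `i` and the other
`l j` are constant on their faces. -/
lemma gridDegree_eq_zero {n m : ℕ} (l : Fin n → (Fin n → ℕ) → ZMod 2) (i : Fin n)
    (hi : ∀ x, x i = 0 ∨ x i = m → l i x = 0)
    (hl : ∀ j ≠ i, ∀ x y, x j = y j → x j = 0 ∨ x j = m → l j x = l j y) :
    gridDegree m l = 0 := by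
  obtain ⟨n, rfl⟩ : ∃ k, n = k + 1 := ⟨n - 1, by have := i.2; omega⟩
  have hsplit : gridDegree m l =
      ∑ z ∈ gridBox (n + 1) m, ∑ σ, shiftedProduct l i (fun j => j) (i + 1) (simplexVertex z σ) -
      ∑ z ∈ gridBox (n + 1) m, ∑ σ, shiftedProduct l i (fun j => j) i (simplexVertex z σ) := by
    unfold gridDegree
    rw [← sum_sub_distrib]
    refine sum_congr rfl fun z _ => ?_
    rw [← sum_sub_distrib]
    refine sum_congr rfl fun σ _ => ?_
    unfold shiftedProduct
    rw [← prod_erase_mul _ _ (mem_univ i)]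
    ring
  rw [hsplit, sub_eq_zero]
  simp_rw [sum_shiftedProduct_raise, sum_shiftedProduct_lower]
  rw [sum_comm, sum_comm (s := gridBox (n + 1) m),
    ← Equiv.sum_comp (Equiv.mulLeft (finRotate (n + 1)))]
  refine sum_congr rfl fun σ _ => ?_
  have hlast : ∀ (z : Fin (n + 1) → ℕ) {k : ℕ}, k ≤ n →
      simplexVertex z σ k (σ.symm (Fin.last n)) = z (σ.symm (Fin.last n)) := by
    intro z k hk
    simp [simplexVertex, hk]
  rw [← sum_gridBox_add_single (fun z => shiftedProduct l i
    (fun j => if j < i then j else j - 1) i (simplexVertex z σ)) (σ.symm (Fin.last n))]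
  · refine sum_congr rfl fun z _ => ?_
    refine shiftedProduct_congr (simplexVertex_finRotate z σ (Nat.lt_succ_iff.1 i.2)) fun j hj => ?_
    have hj' : (j : ℕ) ≠ i := fun h => hj (Fin.ext h)
    have h1 := i.2
    have h2 := j.2
    have h : (if j < i then (j : ℕ) + 1 else j) = (if j < i then (j : ℕ) else j - 1) + 1 := by
      simp only [Fin.lt_def]
      split_ifs <;> omega
    have h' : (if j < i then (j : ℕ) else j - 1) + 1 ≤ n := by
      simp only [Fin.lt_def]
      split_ifs <;> omega
    rw [h]
    exact ⟨simplexVertex_finRotate z σ (by omega), simplexVertex_finRotate z σ h'⟩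
  · intro z hz
    by_cases hji : σ.symm (Fin.last n) = i
    · refine mul_eq_zero_of_right _ (hi _ ?_)
      rwa [← hji, hlast z (by rw [← Nat.lt_succ_iff]; exact Fin.is_lt _)]
    · refine mul_eq_zero_of_left (prod_eq_zero (mem_erase.2 ⟨hji, mem_univ _⟩) ?_) _
      have hj' : ((σ.symm (Fin.last n) : Fin (n + 1)) : ℕ) ≠ i := fun h => hji (Fin.ext h)
      generalize σ.symm (Fin.last n) = j at *
      have h1 := i.2
      have h2 := j.2
      have h' : (if j < i then (j : ℕ) else j - 1) + 1 ≤ n := by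
        simp only [Fin.lt_def]
        split_ifs <;> omega
      rw [sub_eq_zero]
      refine hl _ hji _ _ ?_ ?_
      · rw [hlast z h', hlast z (Nat.le_of_succ_le h')]
      · rwa [hlast z h']

lemma gridDegree_update_sub {n m : ℕ} (l : Fin n → (Fin n → ℕ) → ZMod 2) (i : Fin n)
    (f g : (Fin n → ℕ) → ZMod 2) :
    gridDegree m (Function.update l i (f - g)) =
      gridDegree m (Function.update l i f) - gridDegree m (Function.update l i g) := by
  unfold gridDegree
  rw [← sum_sub_distrib]
  refine sum_congr rfl fun z _ => ?_
  rw [← sum_sub_distrib]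
  refine sum_congr rfl fun σ _ => ?_
  have key : ∀ h : (Fin n → ℕ) → ZMod 2,
      ∏ j, (Function.update l i h j (simplexVertex z σ (j + 1)) -
        Function.update l i h j (simplexVertex z σ j)) =
      (h (simplexVertex z σ (i + 1)) - h (simplexVertex z σ i)) *
      ∏ j ∈ univ.erase i, (l j (simplexVertex z σ (j + 1)) - l j (simplexVertex z σ j)) := by
    intro h
    rw [← mul_prod_erase _ _ (mem_univ i), Function.update_self]
    congr 1
    refine prod_congr rfl fun j hj => ?_
    rw [Function.update_of_ne (ne_of_mem_erase hj)]
  rw [key, key, key, Pi.sub_apply, Pi.sub_apply]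
  ring

lemma gridDegree_standard {n m : ℕ} (hm : 0 < m) :
    gridDegree m (fun (j : Fin n) x => if x j = 0 then 0 else 1) = 1 := by
  unfold gridDegree
  have key : ∀ (z : Fin n → ℕ) (σ : Equiv.Perm (Fin n)),
      ∏ j : Fin n, ((if simplexVertex z σ (j + 1) j = 0 then (0 : ZMod 2) else 1) -
        if simplexVertex z σ j j = 0 then 0 else 1) ≠ 0 → z = 0 ∧ σ = 1 := by
    intro z σ h
    have h' : ∀ j : Fin n, z j = 0 ∧ (σ j : ℕ) = j := by
      intro j
      have hj := prod_ne_zero_iff.1 h j (mem_univ j)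
      by_contra hcon
      refine hj ?_
      have hiff : simplexVertex z σ (j + 1) j = 0 ↔ simplexVertex z σ j j = 0 := by
        unfold simplexVertex
        constructor <;> intro h <;> split_ifs at h ⊢ <;> omega
      simp only [hiff, sub_self]
    exact ⟨funext fun j => (h' j).1, Equiv.ext fun j => Fin.ext (h' j).2⟩
  rw [sum_eq_single (0 : Fin n → ℕ), sum_eq_single (1 : Equiv.Perm (Fin n))]
  · simp [simplexVertex]
  · intro σ _ hσ
    by_contra h
    exact hσ (key _ _ h).2
  · intro h
    exact absurd (mem_univ _) h
  · intro z _ hz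
    refine sum_eq_zero fun σ _ => ?_
    by_contra h
    exact hz (key _ _ h).1
  · intro h
    exact absurd (Fintype.mem_piFinset.2 fun _ => mem_range.2 hm) h

lemma gridDegree_eq_one {n m : ℕ} (hm : 0 < m) (l : Fin n → (Fin n → ℕ) → ZMod 2)
    (h0 : ∀ j x, x j = 0 → l j x = 0) (h1 : ∀ j x, x j = m → l j x = 1) :
    gridDegree m l = 1 := by
  set e : Fin n → (Fin n → ℕ) → ZMod 2 := fun j x => if x j = 0 then 0 else 1
  have e0 : ∀ j x, x j = 0 → e j x = 0 := fun j x h => if_pos h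
  have e1 : ∀ j x, x j = m → e j x = 1 := fun j x h => if_neg (by omega)
  have key : ∀ s : Finset (Fin n), gridDegree m (s.piecewise e l) = gridDegree m l := by
    intro s
    induction s using Finset.induction_on with
    | empty => rw [piecewise_empty]
    | insert i s _ ih =>
      rw [piecewise_insert, ← ih, ← sub_eq_zero]
      nth_rewrite 2 [← Function.update_eq_self i (s.piecewise e l)]
      rw [← gridDegree_update_sub]
      have p0 : ∀ j x, x j = 0 → s.piecewise e l j x = 0 := by
        intro j x hx
        by_cases hj : j ∈ s <;> simp [hj, h0 j x hx, e0 j x hx]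
      have p1 : ∀ j x, x j = m → s.piecewise e l j x = 1 := by
        intro j x hx
        by_cases hj : j ∈ s <;> simp [hj, h1 j x hx, e1 j x hx]
      refine gridDegree_eq_zero _ i ?_ ?_
      · rintro x (hx | hx)
        · rw [Function.update_self, Pi.sub_apply, e0 i x hx, p0 i x hx, sub_zero]
        · rw [Function.update_self, Pi.sub_apply, e1 i x hx, p1 i x hx, sub_self]
      · intro j hj x y hxy hx
        rw [Function.update_of_ne hj]
        rcases hx with hx | hx
        · rw [p0 j x hx, p0 j y (hxy ▸ hx)]
        · rw [p1 j x hx, p1 j y (hxy ▸ hx)]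
  rw [← key univ, piecewise_univ, gridDegree_standard hm]

/-- A combinatorial Poincaré–Miranda theorem: some Freudenthal simplex has, for each `j`, an edge
along which the label `l j` changes. -/
lemma exists_simplex_labels_ne {n m : ℕ} (hm : 0 < m) (l : Fin n → (Fin n → ℕ) → ZMod 2)
    (h0 : ∀ j x, x j = 0 → l j x = 0) (h1 : ∀ j x, x j = m → l j x = 1) :
    ∃ z ∈ gridBox n m, ∃ σ : Equiv.Perm (Fin n), ∀ j : Fin n,
      l j (simplexVertex z σ (j + 1)) ≠ l j (simplexVertex z σ j) := by
  have h : gridDegree m l ≠ 0 := by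
    rw [gridDegree_eq_one hm l h0 h1]
    exact one_ne_zero
  obtain ⟨z, hz, hz'⟩ := exists_ne_zero_of_sum_ne_zero h
  obtain ⟨σ, -, hσ⟩ := exists_ne_zero_of_sum_ne_zero hz'
  exact ⟨z, hz, σ, fun j hj => prod_ne_zero_iff.1 hσ j (mem_univ j) (sub_eq_zero.2 hj)⟩

/-! ### Brouwer's fixed point theorem for the cube -/

lemma exists_dist_lt_of_mapsTo_cube {n : ℕ} {F : (Fin n → ℝ) → Fin n → ℝ}
    (hF : ContinuousOn F (Set.Icc 0 1)) (hmaps : Set.MapsTo F (Set.Icc 0 1) (Set.Icc 0 1))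
    {ε : ℝ} (hε : 0 < ε) : ∃ x ∈ Set.Icc (0 : Fin n → ℝ) 1, dist (F x) x < ε := by
  have huc : UniformContinuousOn (fun x => F x - x) (Set.Icc 0 1) :=
    isCompact_Icc.uniformContinuousOn_of_continuous (hF.sub continuousOn_id)
  obtain ⟨δ, hδ, hunif⟩ := Metric.uniformContinuousOn_iff.1 huc ε hε
  obtain ⟨k, hk⟩ := exists_nat_one_div_lt hδ
  set m : ℕ := k + 1 with hm
  have hm0 : (0 : ℝ) < m := by positivity
  have hmδ : 1 / (m : ℝ) < δ := by simpa [hm] using hk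
  set c : (Fin n → ℕ) → Fin n → ℝ := fun x j => x j / m with hc
  obtain ⟨z, hz, σ, hσ⟩ := exists_simplex_labels_ne (n := n) (m := m) (Nat.succ_pos k)
    (fun j x => if x j ≠ m ∧ (x j = 0 ∨ c x j ≤ F (c x) j) then 0 else 1)
    (fun j x hx => if_pos ⟨by omega, Or.inl hx⟩) (fun j x hx => if_neg fun h => h.1 hx)
  simp only [Fintype.mem_piFinset, mem_range] at hz
  have hcube : ∀ x : Fin n → ℕ, (∀ j, x j ≤ m) → c x ∈ Set.Icc (0 : Fin n → ℝ) 1 := by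
    refine fun x hx => ⟨fun j => by simp only [hc, Pi.zero_apply]; positivity, fun j => ?_⟩
    rw [hc, Pi.one_apply, div_le_one hm0]
    exact_mod_cast hx j
  have hz0 : c z ∈ Set.Icc (0 : Fin n → ℝ) 1 := hcube z fun j => (hz j).le
  have hvc : ∀ t, c (simplexVertex z σ t) ∈ Set.Icc (0 : Fin n → ℝ) 1 := by
    refine fun t => hcube _ fun j => ?_
    have := hz j
    unfold simplexVertex
    split_ifs <;> omega
  have hclose : ∀ t j, |(F (c z) j - c z j) -
      (F (c (simplexVertex z σ t)) j - c (simplexVertex z σ t) j)| < ε := by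
    intro t j
    have hdist : dist (c z) (c (simplexVertex z σ t)) < δ := by
      refine lt_of_le_of_lt ((dist_pi_le_iff (by positivity)).2 fun j => ?_) hmδ
      rw [Real.dist_eq, abs_sub_comm]
      simp only [hc, simplexVertex]
      rw [← sub_div, abs_div, abs_of_pos hm0]
      gcongr
      split_ifs <;> simp
    have := lt_of_le_of_lt (dist_le_pi_dist _ _ j) (hunif _ hz0 _ (hvc t) hdist)
    rwa [Real.dist_eq] at this
  refine ⟨c z, hz0, (dist_pi_lt_iff hε).2 fun j => ?_⟩
  have hpos : ∀ x : Fin n → ℕ, c x ∈ Set.Icc (0 : Fin n → ℝ) 1 →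
      (x j ≠ m ∧ (x j = 0 ∨ c x j ≤ F (c x) j)) → 0 ≤ F (c x) j - c x j := by
    rintro x hx ⟨-, h | h⟩
    · have : c x j = 0 := by simp [hc, h]
      rw [this, sub_zero]
      exact (hmaps hx).1 j
    · exact sub_nonneg.2 h
  have hneg : ∀ x : Fin n → ℕ, c x ∈ Set.Icc (0 : Fin n → ℝ) 1 →
      ¬ (x j ≠ m ∧ (x j = 0 ∨ c x j ≤ F (c x) j)) → F (c x) j - c x j ≤ 0 := by
    intro x hx h
    by_cases hxm : x j = m
    · have : c x j = 1 := by simp only [hc, hxm]; exact div_self hm0.ne'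
      rw [this, sub_nonpos]
      exact (hmaps hx).2 j
    · by_contra hcon
      exact h ⟨hxm, Or.inr (sub_nonneg.1 (not_le.1 hcon).le)⟩
  obtain ⟨a, b, ha, hb⟩ : ∃ a b, 0 ≤ F (c (simplexVertex z σ a)) j - c (simplexVertex z σ a) j ∧
      F (c (simplexVertex z σ b)) j - c (simplexVertex z σ b) j ≤ 0 := by
    have hj := hσ j
    by_cases h1 : simplexVertex z σ (j + 1) j ≠ m ∧ (simplexVertex z σ (j + 1) j = 0 ∨
        c (simplexVertex z σ (j + 1)) j ≤ F (c (simplexVertex z σ (j + 1))) j) <;>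
      by_cases h2 : simplexVertex z σ j j ≠ m ∧ (simplexVertex z σ j j = 0 ∨
        c (simplexVertex z σ j) j ≤ F (c (simplexVertex z σ j)) j)
    · exact absurd (by rw [if_pos h1, if_pos h2]) hj
    · exact ⟨_, _, hpos _ (hvc _) h1, hneg _ (hvc _) h2⟩
    · exact ⟨_, _, hpos _ (hvc _) h2, hneg _ (hvc _) h1⟩
    · exact absurd (by rw [if_neg h1, if_neg h2]) hj
  have h1 := (abs_lt.1 (hclose a j)).1
  have h2 := (abs_lt.1 (hclose b j)).2
  rw [Real.dist_eq, abs_lt]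
  constructor <;> linarith

/-- **Brouwer's fixed point theorem** for the cube `[0, 1]ⁿ`. -/
lemma exists_fixedPoint_of_mapsTo_cube_fin {n : ℕ} {F : (Fin n → ℝ) → Fin n → ℝ}
    (hF : ContinuousOn F (Set.Icc 0 1)) (hmaps : Set.MapsTo F (Set.Icc 0 1) (Set.Icc 0 1)) :
    ∃ x ∈ Set.Icc (0 : Fin n → ℝ) 1, F x = x := by
  obtain ⟨x, hx, hmin⟩ := isCompact_Icc.exists_isMinOn
    (Set.nonempty_Icc.2 (zero_le_one (α := Fin n → ℝ))) (continuous_dist.comp_continuousOn (hF.prodMk continuousOn_id))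
  refine ⟨x, hx, ?_⟩
  by_contra hne
  obtain ⟨y, hy, hlt⟩ := exists_dist_lt_of_mapsTo_cube hF hmaps (dist_pos.2 hne)
  exact absurd (hmin hy) (not_le.2 hlt)

/-- **Brouwer's fixed point theorem** for the cube `[0, 1]^ι`, `ι` finite. -/
lemma exists_fixedPoint_of_mapsTo_cube {ι : Type*} [Fintype ι] {F : (ι → ℝ) → ι → ℝ}
    (hF : ContinuousOn F (Set.Icc 0 1)) (hmaps : Set.MapsTo F (Set.Icc 0 1) (Set.Icc 0 1)) :
    ∃ x ∈ Set.Icc (0 : ι → ℝ) 1, F x = x := by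
  let e := Fintype.equivFin ι
  have hcube : Set.MapsTo (fun (x : Fin (Fintype.card ι) → ℝ) a => x (e a))
      (Set.Icc 0 1) (Set.Icc 0 1) :=
    fun x hx => ⟨fun a => hx.1 (e a), fun a => hx.2 (e a)⟩
  obtain ⟨x, hx, hfix⟩ := exists_fixedPoint_of_mapsTo_cube_fin
    (F := fun x k => F (fun a => x (e a)) (e.symm k))
    (continuousOn_pi.2 fun k => (continuous_apply (e.symm k)).comp_continuousOn
      (hF.comp (by fun_prop) hcube))
    (fun x hx => ⟨fun k => (hmaps (hcube hx)).1 _, fun k => (hmaps (hcube hx)).2 _⟩)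
  refine ⟨_, hcube hx, funext fun a => ?_⟩
  simpa using congrFun hfix (e a)

/-! ### Generalized equilibria -/

/-- A retraction of the nonnegative orthant onto the simplex, extended to all vectors. -/
noncomputable def simplexRetract {A : Type*} [Fintype A] (q : A → ℝ) (a : A) : ℝ :=
  (|q a| + max 0 (1 - ∑ b, |q b|) / Fintype.card A) / max 1 (∑ b, |q b|)

lemma continuous_simplexRetract {A : Type*} [Fintype A] :
    Continuous (simplexRetract : (A → ℝ) → A → ℝ) := by
  refine continuous_pi fun a => ?_
  unfold simplexRetract
  refine Continuous.div (by fun_prop) (by fun_prop) fun q => ?_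
  exact (lt_of_lt_of_le one_pos (le_max_left _ _)).ne'

lemma simplexRetract_nonneg {A : Type*} [Fintype A] (q : A → ℝ) (a : A) :
    0 ≤ simplexRetract q a := by
  unfold simplexRetract
  positivity

lemma sum_simplexRetract {A : Type*} [Fintype A] [Nonempty A] (q : A → ℝ) :
    ∑ a, simplexRetract q a = 1 := by
  have hcard : (Fintype.card A : ℝ) ≠ 0 := Nat.cast_ne_zero.2 Fintype.card_ne_zero
  unfold simplexRetract
  rw [← sum_div, sum_add_distrib, sum_const, card_univ, nsmul_eq_mul, mul_div_cancel₀ _ hcard,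
    div_eq_one_iff_eq (lt_of_lt_of_le one_pos (le_max_left _ _)).ne']
  rcases le_total (∑ b, |q b|) 1 with h | h
  · rw [max_eq_right (sub_nonneg.2 h), max_eq_left h]
    ring
  · rw [max_eq_left (sub_nonpos.2 h), max_eq_right h, add_zero]

lemma simplexRetract_eq_self {A : Type*} [Fintype A] {q : A → ℝ} (hq : ∀ a, 0 ≤ q a)
    (hsum : ∑ a, q a = 1) : simplexRetract q = q := by
  funext a
  simp [simplexRetract, abs_of_nonneg (hq _), hsum]

section Game

variable {n : ℕ} {S : Fin n → Type*} [∀ i, Fintype (S i)]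

lemma isProfile_simplexRetract [∀ i, Nonempty (S i)] (q : ∀ i, S i → ℝ) :
    IsProfile fun i => simplexRetract (q i) :=
  ⟨fun i => simplexRetract_nonneg (q i), fun i => sum_simplexRetract (q i)⟩

lemma continuous_actionPayoff [∀ i, DecidableEq (S i)] (u : ∀ _ : Fin n, (∀ j, S j) → ℝ)
    (i : Fin n) (a : S i) : Continuous fun p : ∀ i, S i → ℝ => actionPayoff u p i a := by
  unfold actionPayoff
  refine continuous_finsetSum _ fun x _ => ?_
  split_ifs
  · fun_prop
  · exact continuous_const

lemma actionPayoff_pos [∀ i, DecidableEq (S i)] {u : ∀ _ : Fin n, (∀ j, S j) → ℝ}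
    (hu : ∀ i x, 0 < u i x) {p : ∀ i, S i → ℝ} (hp : IsProfile p) (i : Fin n) (a : S i) :
    0 < actionPayoff u p i a := by
  have hpos : ∀ j, ∃ b, 0 < p j b := by
    intro j
    by_contra! h
    have := sum_nonpos fun b (_ : b ∈ univ) => h b
    rw [hp.2 j] at this
    exact absurd this (by norm_num)
  choose b hb using hpos
  refine sum_pos' (fun x _ => ?_) ⟨Function.update b i a, mem_univ _, ?_⟩
  · split_ifs
    · exact mul_nonneg (hu i x).le (prod_nonneg fun j _ => hp.1 j (x j))
    · exact le_rfl
  · rw [if_pos (Function.update_self i a b)]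
    refine mul_pos (hu _ _) (prod_pos fun j hj => ?_)
    rw [Function.update_of_ne (ne_of_mem_erase hj)]
    exact hb j

end Game

/-- Existence of a generalized equilibrium for any selfishness levels `α i ≥ 0`:
there is a strategy profile `p` with
`p i a = u_i(a, p_{-i})^(α i) / ∑_b u_i(b, p_{-i})^(α i)` for all `i`, `a`. -/
theorem generalized_equilibrium_exists
    {n : ℕ} {S : Fin n → Type*} [∀ i, Fintype (S i)] [∀ i, Nonempty (S i)]
    [∀ i, DecidableEq (S i)]
    (u : ∀ _ : Fin n, (∀ j, S j) → ℝ) (hu : ∀ i x, 0 < u i x)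
    (α : Fin n → ℝ) (hα : ∀ i, 0 ≤ α i) :
    ∃ p : ∀ i, S i → ℝ, IsProfile p ∧ ∀ i (a : S i),
      p i a = actionPayoff u p i a ^ α i / ∑ b, actionPayoff u p i b ^ α i := by
  let P : (∀ i, S i → ℝ) → ∀ i, S i → ℝ := fun q i a =>
    actionPayoff u (fun i => simplexRetract (q i)) i a ^ α i /
      ∑ b, actionPayoff u (fun i => simplexRetract (q i)) i b ^ α i
  have hpos : ∀ (q : ∀ i, S i → ℝ) i (a : S i), 0 < actionPayoff u (fun i => simplexRetract (q i)) i a ^ α i :=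
    fun q i a => Real.rpow_pos_of_pos (actionPayoff_pos hu (isProfile_simplexRetract q) i a) _
  have hsum : ∀ (q : ∀ i, S i → ℝ) i, 0 < ∑ b, actionPayoff u (fun i => simplexRetract (q i)) i b ^ α i :=
    fun q i => sum_pos (fun b _ => hpos q i b) univ_nonempty
  have hcont : ∀ i (a : S i), Continuous fun q : ∀ i, S i → ℝ =>
      actionPayoff u (fun i => simplexRetract (q i)) i a ^ α i := fun i a =>
    ((continuous_actionPayoff u i a).comp (continuous_pi fun j =>
      continuous_simplexRetract.comp (continuous_apply j))).rpow_const fun _ => Or.inr (hα i)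
  have hP : ∀ q, IsProfile (P q) := fun q =>
    ⟨fun i a => div_nonneg (hpos q i a).le (hsum q i).le, fun i => by
      rw [← sum_div, div_self (hsum q i).ne']⟩
  have hPcont : ∀ i (a : S i), Continuous fun q => P q i a := fun i a =>
    (hcont i a).div (continuous_finsetSum _ fun b _ => hcont i b) fun q => (hsum q i).ne'
  have hle : ∀ q i (a : S i), P q i a ≤ 1 := fun q i a =>
    (single_le_sum (fun a _ => (hP q).1 i a) (mem_univ a)).trans_eq ((hP q).2 i)
  let F : ((Σ i, S i) → ℝ) → (Σ i, S i) → ℝ := fun q c => P (fun i a => q ⟨i, a⟩) c.1 c.2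
  have hF : Continuous F := continuous_pi fun c => (hPcont c.1 c.2).comp
    (continuous_pi fun i => continuous_pi fun a => continuous_apply (⟨i, a⟩ : Σ i, S i))
  obtain ⟨q, -, hq⟩ := exists_fixedPoint_of_mapsTo_cube hF.continuousOn
    fun q _ => ⟨fun c => (hP _).1 c.1 c.2, fun c => hle _ c.1 c.2⟩
  have hfix : P (fun i a => q ⟨i, a⟩) = fun i a => q ⟨i, a⟩ :=
    funext fun i => funext fun a => congrFun hq ⟨i, a⟩
  generalize (fun i a => q ⟨i, a⟩ : ∀ i, S i → ℝ) = p at hfix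
  have hp : IsProfile p := hfix ▸ hP p
  have hretract : (fun i => simplexRetract (p i)) = p :=
    funext fun i => simplexRetract_eq_self (hp.1 i) (hp.2 i)
  refine ⟨p, hp, fun i a => ?_⟩
  have := congrFun (congrFun hfix i) a
  simp only [P, hretract] at this
  exact this.symm
end

section
/- Let S be a finite set with m = |S| ≥ 2 elements, let v : S → ℝ be strictly positive, and let α ≥ 1 be a real number. Define the probability distribution q on S by q(x) = v(x)^α / Σ_{y ∈ S} v(y)^α. Then 0 ≤ max_{x ∈ S} v(x) − Σ_{x ∈ S} v(x) q(x) < ((m − 1)/e) · (max_{x ∈ S} v(x)) · α^{-1}. -/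
open Finset

/-- On `(0, 1]`, the function `t ↦ (1 - t) * t ^ α` is strictly below `1 / (e * α)`. -/
theorem one_sub_mul_rpow_lt {t α : ℝ} (ht : 0 < t) (ht1 : t ≤ 1) (hα : 0 < α) :
    (1 - t) * t ^ α < (Real.exp 1)⁻¹ * α⁻¹ := by
  rcases ht1.eq_or_lt with rfl | ht1
  · rw [sub_self, zero_mul]
    positivity
  have hs : 0 < α * (1 - t) := mul_pos hα (sub_pos.2 ht1)
  have hpow : t ^ α < Real.exp (-(α * (1 - t))) := by
    have h := Real.rpow_lt_rpow ht.le
      (by linarith [Real.add_one_lt_exp (sub_ne_zero.2 ht1.ne)] : t < Real.exp (t - 1)) hα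
    rwa [← Real.exp_mul, show (t - 1) * α = -(α * (1 - t)) by ring] at h
  have hexp : α * (1 - t) * Real.exp (-(α * (1 - t))) ≤ (Real.exp 1)⁻¹ :=
    calc α * (1 - t) * Real.exp (-(α * (1 - t)))
        ≤ Real.exp (α * (1 - t) - 1) * Real.exp (-(α * (1 - t))) := by
          gcongr
          linarith [Real.add_one_le_exp (α * (1 - t) - 1)]
      _ = (Real.exp 1)⁻¹ := by
          rw [← Real.exp_add, ← Real.exp_neg]
          ring_nf
  rw [← div_eq_mul_inv, lt_div_iff₀ hα]
  calc (1 - t) * t ^ α * α = α * (1 - t) * t ^ α := by ring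
    _ < α * (1 - t) * Real.exp (-(α * (1 - t))) := by gcongr
    _ ≤ _ := hexp

/-- Gap between the maximum of a positive function `v` on a finite set with `m ≥ 2`
elements and its expectation under the normalized `α`-th power distribution:
`0 ≤ max v − ∑ v·q < ((m−1)/e)·(max v)·α⁻¹` for `α ≥ 1`. -/
theorem max_sub_expectation_bound
    {S : Type*} [Fintype S] [Nonempty S] (hcard : 2 ≤ Fintype.card S)
    (v : S → ℝ) (hv : ∀ x, 0 < v x) (α : ℝ) (hα : 1 ≤ α) :
    0 ≤ univ.sup' univ_nonempty v - ∑ x, v x * (v x ^ α / ∑ y, v y ^ α) ∧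
    univ.sup' univ_nonempty v - ∑ x, v x * (v x ^ α / ∑ y, v y ^ α)
      < ((Fintype.card S : ℝ) - 1) / Real.exp 1 * univ.sup' univ_nonempty v * α⁻¹ := by
  classical
  obtain ⟨x₀, -, hx₀⟩ := exists_mem_eq_sup' univ_nonempty v
  have hmax (x : S) : v x ≤ v x₀ := hx₀ ▸ le_sup' v (mem_univ x)
  rw [hx₀]
  have hM := hv x₀
  have hα₀ : 0 < α := by linarith
  have hpos (x : S) : 0 < v x ^ α := Real.rpow_pos_of_pos (hv x) α
  set Z := ∑ y, v y ^ α with hZ_def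
  have hMZ : v x₀ ^ α ≤ Z := single_le_sum (fun x _ ↦ (hpos x).le) (mem_univ x₀)
  have hZ : 0 < Z := (hpos x₀).trans_le hMZ
  have hgap : v x₀ - ∑ x, v x * (v x ^ α / Z) = ∑ x, (v x₀ - v x) * (v x ^ α / Z) := by
    simp_rw [sub_mul, sum_sub_distrib, ← mul_sum, ← sum_div, ← hZ_def]
    rw [div_self hZ.ne', mul_one]
  rw [hgap]
  refine ⟨sum_nonneg fun x _ ↦
    mul_nonneg (sub_nonneg.2 (hmax x)) (div_nonneg (hpos x).le hZ.le), ?_⟩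
  have hterm (x : S) :
      (v x₀ - v x) * (v x ^ α / Z) < v x₀ * ((Real.exp 1)⁻¹ * α⁻¹) :=
    calc (v x₀ - v x) * (v x ^ α / Z)
        ≤ (v x₀ - v x) * (v x ^ α / v x₀ ^ α) :=
          mul_le_mul_of_nonneg_left (div_le_div_of_nonneg_left (hpos x).le (hpos x₀) hMZ)
            (sub_nonneg.2 (hmax x))
      _ = v x₀ * ((1 - v x / v x₀) * (v x / v x₀) ^ α) := by
          rw [Real.div_rpow (hv x).le hM.le, ← mul_assoc, mul_sub, mul_one,
            mul_div_cancel₀ _ hM.ne']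
      _ < v x₀ * ((Real.exp 1)⁻¹ * α⁻¹) := mul_lt_mul_of_pos_left
          (one_sub_mul_rpow_lt (div_pos (hv x) hM) ((div_le_one hM).2 (hmax x)) hα₀) hM
  have hcard_erase : #(univ.erase x₀) = Fintype.card S - 1 := by
    rw [card_erase_of_mem (mem_univ x₀), card_univ]
  rw [← add_sum_erase univ _ (mem_univ x₀), sub_self, zero_mul, zero_add]
  calc ∑ x ∈ univ.erase x₀, (v x₀ - v x) * (v x ^ α / Z)
      < ∑ x ∈ univ.erase x₀, v x₀ * ((Real.exp 1)⁻¹ * α⁻¹) :=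
        sum_lt_sum_of_nonempty (card_pos.1 (by omega)) fun x _ ↦ hterm x
    _ = ((Fintype.card S : ℝ) - 1) / Real.exp 1 * v x₀ * α⁻¹ := by
        rw [sum_const, hcard_erase, nsmul_eq_mul, Nat.cast_sub (by omega), Nat.cast_one]
        ring
end

section
/- Let S be a nonempty finite set, let p be a probability distribution on S (so p(x) ≥ 0 and Σ_{x∈S} p(x) = 1, with p(x) > 0 for at least one x), and let M > 0. For ε > 0 define Ψ_ε : S → ℝ by Ψ_ε(x) = M(1 + ε ln p(x)) if p(x) > 0 and Ψ_ε(x) = M(1 + ε ln ε) if p(x) = 0. Then for every x ∈ S, the normalized power Ψ_ε(x)^{1/ε} / Σ_{y ∈ S} Ψ_ε(y)^{1/ε} converges to p(x) as ε → 0⁺. -/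
open Filter Classical

lemma tendsto_one_add_mul_rpow_one_div (t : ℝ) :
    Tendsto (fun ε : ℝ => (1 + ε * t) ^ (1 / ε)) (nhdsWithin 0 (Set.Ioi 0))
      (nhds (Real.exp t)) := by
  refine ((Real.tendsto_one_add_div_rpow_exp t).comp tendsto_inv_nhdsGT_zero).congr
    fun ε => ?_
  simp [mul_comm]

lemma eventually_one_add_mul_log_pos :
    ∀ᶠ ε : ℝ in nhdsWithin 0 (Set.Ioi 0), 0 < 1 + ε * Real.log ε := by
  have h : Tendsto (fun ε : ℝ => 1 + ε * Real.log ε) (nhdsWithin 0 (Set.Ioi 0)) (nhds 1) := by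
    have hc : Continuous fun ε : ℝ => 1 + ε * Real.log ε :=
      continuous_const.add Real.continuous_mul_log
    have := hc.tendsto 0
    simp only [zero_mul, add_zero] at this
    exact this.mono_left nhdsWithin_le_nhds
  exact h.eventually (lt_mem_nhds one_pos)

lemma tendsto_one_add_mul_log_rpow_one_div :
    Tendsto (fun ε : ℝ => (1 + ε * Real.log ε) ^ (1 / ε)) (nhdsWithin 0 (Set.Ioi 0))
      (nhds 0) := by
  refine tendsto_of_tendsto_of_tendsto_of_le_of_le' tendsto_const_nhds
    (tendsto_id.mono_left nhdsWithin_le_nhds : Tendsto (fun ε : ℝ => ε) _ _) ?_ ?_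
  · filter_upwards [eventually_one_add_mul_log_pos] with ε h using Real.rpow_nonneg h.le _
  · filter_upwards [eventually_one_add_mul_log_pos, self_mem_nhdsWithin] with ε h (hε : 0 < ε)
    calc (1 + ε * Real.log ε) ^ (1 / ε)
        ≤ Real.exp (ε * Real.log ε) ^ (1 / ε) := by
          refine Real.rpow_le_rpow h.le ?_ (by positivity)
          linarith [Real.add_one_le_exp (ε * Real.log ε)]
      _ = ε := by
          rw [← Real.exp_mul, show ε * Real.log ε * (1 / ε) = Real.log ε by field_simp,
            Real.exp_log hε]

lemma tendsto_perturbed_rpow_one_div {a : ℝ} (ha : 0 ≤ a) :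
    Tendsto (fun ε : ℝ =>
        (if 0 < a then 1 + ε * Real.log a else 1 + ε * Real.log ε) ^ (1 / ε))
      (nhdsWithin 0 (Set.Ioi 0)) (nhds a) := by
  rcases ha.eq_or_lt with rfl | h
  · simpa using tendsto_one_add_mul_log_rpow_one_div
  · simpa [h, Real.exp_log h] using tendsto_one_add_mul_rpow_one_div (Real.log a)

lemma eventually_perturbed_pos (a : ℝ) :
    ∀ᶠ ε : ℝ in nhdsWithin 0 (Set.Ioi 0),
      0 < if 0 < a then 1 + ε * Real.log a else 1 + ε * Real.log ε := by
  split_ifs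
  · have h : Tendsto (fun ε : ℝ => 1 + ε * Real.log a) (nhds 0) (nhds 1) := by
      have := (by fun_prop : Continuous fun ε : ℝ => 1 + ε * Real.log a).tendsto 0
      simpa using this
    exact nhdsWithin_le_nhds (h.eventually (lt_mem_nhds one_pos))
  · exact eventually_one_add_mul_log_pos

/-- Let `p` be a probability distribution on a nonempty finite set `S` and `M > 0`.
With `Ψ_ε(x) = M(1 + ε ln p(x))` when `p(x) > 0` and `Ψ_ε(x) = M(1 + ε ln ε)` when
`p(x) = 0`, the normalized power `Ψ_ε(x)^(1/ε) / ∑_y Ψ_ε(y)^(1/ε)` converges to `p(x)`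
as `ε → 0⁺`, for every `x`. -/
theorem normalized_power_of_perturbed_payoff_tendsto
    {S : Type*} [Fintype S] [Nonempty S]
    (p : S → ℝ) (hp0 : ∀ x, 0 ≤ p x) (hp1 : ∑ x, p x = 1) (hpos : ∃ x, 0 < p x)
    (M : ℝ) (hM : 0 < M) :
    ∀ x : S,
      Tendsto
        (fun ε : ℝ =>
          (if 0 < p x then M * (1 + ε * Real.log (p x)) else M * (1 + ε * Real.log ε))
              ^ (1 / ε)
            / ∑ y,
              (if 0 < p y then M * (1 + ε * Real.log (p y)) else M * (1 + ε * Real.log ε))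
                ^ (1 / ε))
        (nhdsWithin 0 (Set.Ioi 0)) (nhds (p x)) := by
  intro x
  have hlim := (tendsto_perturbed_rpow_one_div (hp0 x)).div
    (tendsto_finsetSum Finset.univ fun y _ => tendsto_perturbed_rpow_one_div (hp0 y))
    (by simp [hp1])
  rw [hp1, div_one] at hlim
  refine hlim.congr' ?_
  filter_upwards [eventually_all.2 fun y => eventually_perturbed_pos (p y)] with ε hε
  have hmul (y : S) :
      (if 0 < p y then M * (1 + ε * Real.log (p y)) else M * (1 + ε * Real.log ε)) ^ (1 / ε)
        = M ^ (1 / ε) *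
          (if 0 < p y then 1 + ε * Real.log (p y) else 1 + ε * Real.log ε) ^ (1 / ε) := by
    rw [← Real.mul_rpow hM.le (hε y).le, mul_ite]
  simp_rw [hmul, ← Finset.mul_sum]
  exact (mul_div_mul_left _ _ (Real.rpow_pos_of_pos hM _).ne').symm
end

section
/- Consider the cooperative-optimization iteration on n agents with nonempty finite variable domains D_1, …, D_n, sub-objective functions E_i : D_1 × ⋯ × D_n → ℝ, a propagation matrix W = (w_{ij}) that is nonnegative, has column sums one (Σ_{i=1}^n w_{ij} = 1 for every j), and is irreducible and aperiodic (equivalently, some power of W has all entries strictly positive), and a constant cooperation strength λ with 0 ≤ λ < 1. Define the update operator T on tuples Ψ = (Ψ_1, …, Ψ_n) of real-valued functions Ψ_i : D_i → ℝ by T(Ψ)_i(x_i) = max over all profiles x with i-th coordinate x_i of (E_i(x) + λ Σ_{j ≠ i} w_{ij} Ψ_j(x_j)). Then T has exactly one fixed point Ψ*, and the iterates Ψ(t) = T^t(Ψ(0)) converge to Ψ* at an exponential rate regardless of the initial tuple Ψ(0): there exist r ∈ [0,1) and, for each Ψ(0), a constant C such that max_i max_{x_i} |Ψ_i(t)(x_i)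 − Ψ*_i(x_i)| ≤ C r^t for all t. -/
open Finset

/-- The cooperative-optimization update operator:
`T(Ψ)_i(a) = max over profiles x with i-th coordinate a of
(E_i(x) + λ ∑_{j ≠ i} w_{ij} Ψ_j(x_j))`. -/
noncomputable def coopUpdate {n : ℕ} {D : Fin n → Type*}
    [∀ i, Fintype (D i)] [∀ i, Nonempty (D i)]
    (E : ∀ _ : Fin n, (∀ j, D j) → ℝ) (W : Matrix (Fin n) (Fin n) ℝ) (lam : ℝ)
    (Ψ : ∀ i, D i → ℝ) : ∀ i, D i → ℝ :=
  fun i a =>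
    univ.sup' univ_nonempty (fun x : ∀ j, D j =>
      E i (Function.update x i a) + lam * ∑ j ∈ univ.erase i, W i j * Ψ j (x j))

/-- Coordinatewise Lipschitz estimate for the update operator in the sup norms of the agents. -/
lemma dist_coopUpdate_le {n : ℕ} {D : Fin n → Type*}
    [∀ i, Fintype (D i)] [∀ i, Nonempty (D i)]
    (E : ∀ _ : Fin n, (∀ j, D j) → ℝ) (W : Matrix (Fin n) (Fin n) ℝ)
    (hW0 : ∀ i j, 0 ≤ W i j) {lam : ℝ} (hlam0 : 0 ≤ lam) (Ψ Φ : ∀ i, D i → ℝ) (i : Fin n) :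
    dist (coopUpdate E W lam Ψ i) (coopUpdate E W lam Φ i) ≤
      lam * ∑ j, W i j * dist (Ψ j) (Φ j) := by
  have one_sided : ∀ (Ψ Φ : ∀ i, D i → ℝ) (a : D i),
      coopUpdate E W lam Ψ i a ≤
        coopUpdate E W lam Φ i a + lam * ∑ j, W i j * dist (Ψ j) (Φ j) := by
    intro Ψ Φ a
    refine Finset.sup'_le _ _ fun x _ => ?_
    have hΦ : E i (Function.update x i a) + lam * ∑ j ∈ univ.erase i, W i j * Φ j (x j) ≤
        coopUpdate E W lam Φ i a :=
      Finset.le_sup' (fun x : ∀ j, D j =>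
        E i (Function.update x i a) + lam * ∑ j ∈ univ.erase i, W i j * Φ j (x j)) (mem_univ x)
    have hsum : ∑ j ∈ univ.erase i, W i j * Ψ j (x j) ≤
        ∑ j ∈ univ.erase i, W i j * Φ j (x j) + ∑ j, W i j * dist (Ψ j) (Φ j) := by
      calc ∑ j ∈ univ.erase i, W i j * Ψ j (x j)
          ≤ ∑ j ∈ univ.erase i, (W i j * Φ j (x j) + W i j * dist (Ψ j) (Φ j)) := by
            refine Finset.sum_le_sum fun j _ => ?_
            rw [← mul_add]
            refine mul_le_mul_of_nonneg_left ?_ (hW0 i j)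
            have h := dist_le_pi_dist (Ψ j) (Φ j) (x j)
            rw [Real.dist_eq] at h
            linarith [le_abs_self (Ψ j (x j) - Φ j (x j))]
        _ = ∑ j ∈ univ.erase i, W i j * Φ j (x j) +
              ∑ j ∈ univ.erase i, W i j * dist (Ψ j) (Φ j) := Finset.sum_add_distrib
        _ ≤ _ := by
            gcongr
            · exact fun j _ _ => mul_nonneg (hW0 i j) dist_nonneg
            · exact Finset.subset_univ _
    linarith [mul_le_mul_of_nonneg_left hsum hlam0]
  have hnonneg : 0 ≤ lam * ∑ j, W i j * dist (Ψ j) (Φ j) :=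
    mul_nonneg hlam0 (Finset.sum_nonneg fun j _ => mul_nonneg (hW0 i j) dist_nonneg)
  refine (dist_pi_le_iff hnonneg).2 fun a => ?_
  have h₁ := one_sided Ψ Φ a
  have h₂ := one_sided Φ Ψ a
  simp only [dist_comm (Φ _) (Ψ _)] at h₂
  rw [Real.dist_eq, abs_le]
  constructor <;> linarith

/-- For a column-stochastic `W`, the update operator contracts the `ℓ¹` sum of the agents' sup
distances by the factor `lam`. -/
lemma sum_dist_coopUpdate_le {n : ℕ} {D : Fin n → Type*}
    [∀ i, Fintype (D i)] [∀ i, Nonempty (D i)]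
    (E : ∀ _ : Fin n, (∀ j, D j) → ℝ) (W : Matrix (Fin n) (Fin n) ℝ)
    (hW0 : ∀ i j, 0 ≤ W i j) (hWcol : ∀ j, ∑ i, W i j = 1)
    {lam : ℝ} (hlam0 : 0 ≤ lam) (Ψ Φ : ∀ i, D i → ℝ) :
    ∑ i, dist (coopUpdate E W lam Ψ i) (coopUpdate E W lam Φ i) ≤
      lam * ∑ i, dist (Ψ i) (Φ i) := by
  calc ∑ i, dist (coopUpdate E W lam Ψ i) (coopUpdate E W lam Φ i)
      ≤ ∑ i, lam * ∑ j, W i j * dist (Ψ j) (Φ j) :=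
        Finset.sum_le_sum fun i _ => dist_coopUpdate_le E W hW0 hlam0 Ψ Φ i
    _ = lam * ∑ i, dist (Ψ i) (Φ i) := by
        rw [← Finset.mul_sum, Finset.sum_comm]
        simp only [← Finset.sum_mul, hWcol, one_mul]

/-- The update operator on assignment states with the `ℓ¹` sum of the agents' sup norms. -/
noncomputable def coopUpdateL1 {n : ℕ} {D : Fin n → Type*}
    [∀ i, Fintype (D i)] [∀ i, Nonempty (D i)]
    (E : ∀ _ : Fin n, (∀ j, D j) → ℝ) (W : Matrix (Fin n) (Fin n) ℝ) (lam : ℝ)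
    (Ψ : PiLp 1 fun i => D i → ℝ) : PiLp 1 fun i => D i → ℝ :=
  WithLp.toLp 1 (coopUpdate E W lam (WithLp.ofLp Ψ))

lemma contractingWith_coopUpdateL1 {n : ℕ} {D : Fin n → Type*}
    [∀ i, Fintype (D i)] [∀ i, Nonempty (D i)]
    (E : ∀ _ : Fin n, (∀ j, D j) → ℝ) (W : Matrix (Fin n) (Fin n) ℝ)
    (hW0 : ∀ i j, 0 ≤ W i j) (hWcol : ∀ j, ∑ i, W i j = 1)
    {lam : ℝ} (hlam0 : 0 ≤ lam) (hlam1 : lam < 1) :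
    ContractingWith ⟨lam, hlam0⟩ (coopUpdateL1 E W lam) := by
  refine ⟨hlam1, LipschitzWith.of_dist_le_mul fun Ψ Φ => ?_⟩
  rw [PiLp.dist_eq_of_L1, PiLp.dist_eq_of_L1]
  exact sum_dist_coopUpdate_le E W hW0 hWcol hlam0 (WithLp.ofLp Ψ) (WithLp.ofLp Φ)

/-- For a nonnegative, column-stochastic, primitive propagation matrix `W` and
cooperation strength `0 ≤ λ < 1`, the cooperative-optimization update operator has a
unique fixed point, and its iterates converge to it exponentially fast from any
initial state. -/
theorem coopUpdate_unique_fixedPoint_and_exponential_convergence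
    {n : ℕ} {D : Fin n → Type*} [∀ i, Fintype (D i)] [∀ i, Nonempty (D i)]
    (E : ∀ _ : Fin n, (∀ j, D j) → ℝ) (W : Matrix (Fin n) (Fin n) ℝ)
    (hW0 : ∀ i j, 0 ≤ W i j) (hWcol : ∀ j, ∑ i, W i j = 1)
    (hWprim : ∃ k : ℕ, 1 ≤ k ∧ ∀ i j, 0 < (W ^ k) i j)
    (lam : ℝ) (hlam0 : 0 ≤ lam) (hlam1 : lam < 1) :
    ∃ Ψstar : ∀ i, D i → ℝ,
      coopUpdate E W lam Ψstar = Ψstar ∧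
      (∀ Φ : ∀ i, D i → ℝ, coopUpdate E W lam Φ = Φ → Φ = Ψstar) ∧
      ∃ r : ℝ, 0 ≤ r ∧ r < 1 ∧
        ∀ Ψ0 : ∀ i, D i → ℝ, ∃ C : ℝ, ∀ t : ℕ, ∀ i (a : D i),
          |(coopUpdate E W lam)^[t] Ψ0 i a - Ψstar i a| ≤ C * r ^ t := by
  have hc := contractingWith_coopUpdateL1 E W hW0 hWcol hlam0 hlam1
  set P := ContractingWith.fixedPoint (coopUpdateL1 E W lam) hc with hP
  refine ⟨WithLp.ofLp P, congrArg WithLp.ofLp hc.fixedPoint_isFixedPt, fun Φ hΦ => ?_,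
    lam, hlam0, hlam1, fun Ψ0 => ?_⟩
  · have hfix : Function.IsFixedPt (coopUpdateL1 E W lam) (WithLp.toLp 1 Φ) :=
      congrArg (WithLp.toLp 1) hΦ
    exact congrArg WithLp.ofLp (hc.fixedPoint_unique hfix)
  · refine ⟨dist (WithLp.toLp 1 Ψ0) (coopUpdateL1 E W lam (WithLp.toLp 1 Ψ0)) / (1 - lam),
      fun t i a => ?_⟩
    have hsemi : Function.Semiconj (WithLp.toLp 1) (coopUpdate E W lam) (coopUpdateL1 E W lam) :=
      fun _ => rfl
    have hiter := (hsemi.iterate_right t) Ψ0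
    have hbound := hc.apriori_dist_iterate_fixedPoint_le (WithLp.toLp 1 Ψ0) t
    rw [← hiter, ← hP, PiLp.dist_eq_of_L1] at hbound
    calc |(coopUpdate E W lam)^[t] Ψ0 i a - P i a|
        ≤ dist ((coopUpdate E W lam)^[t] Ψ0 i) (P i) :=
          dist_le_pi_dist ((coopUpdate E W lam)^[t] Ψ0 i) (P i) a
      _ ≤ ∑ j, dist ((coopUpdate E W lam)^[t] Ψ0 j) (P j) :=
          Finset.single_le_sum (f := fun j => dist ((coopUpdate E W lam)^[t] Ψ0 j) (P j))
            (fun _ _ => dist_nonneg) (mem_univ i)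
      _ ≤ _ := by
          rw [div_mul_eq_mul_div]
          exact hbound
end

section
/- Consider the cooperative-optimization setting on n agents with nonempty finite variable domains D_1, …, D_n, sub-objective functions E_i : D_1 × ⋯ × D_n → ℝ, a propagation matrix W = (w_{ij}) that is nonnegative, has zero diagonal (w_{jj} = 0 for every j), and has column sums one (Σ_{i=1}^n w_{ij} = 1 for every j), and a constant cooperation strength λ with 0 ≤ λ < 1. Suppose Ψ* = (Ψ*_1, …, Ψ*_n) is an equilibrium, i.e., for every i and every x_i ∈ D_i, Ψ*_i(x_i) = max over all profiles x with i-th coordinate x_i of (E_i(x) + λ Σ_{j ≠ i} w_{ij} Ψ*_j(x_j)). Suppose further that the profile x̃ is a consensus solution: for every i, x̃ maximizes the compromised objective x ↦ E_i(x) + λ Σ_{j ≠ i} w_{ij} Ψ*_j(x_j) over all profiles x. Then x̃ is a global maximizer of the global objective function E(x) = Σ_{i=1}^n E_i(x). -/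
open Finset

/-- The compromised objective of agent `i` given others' assignment state functions:
`x ↦ E_i(x) + λ ∑_{j ≠ i} w_{ij} Ψ_j(x_j)`. -/
noncomputable def compromised {n : ℕ} {D : Fin n → Type*} [∀ i, Fintype (D i)]
    (E : ∀ _ : Fin n, (∀ j, D j) → ℝ) (W : Matrix (Fin n) (Fin n) ℝ) (lam : ℝ)
    (Ψ : ∀ i, D i → ℝ) (i : Fin n) (x : ∀ j, D j) : ℝ :=
  E i x + lam * ∑ j ∈ univ.erase i, W i j * Ψ j (x j)

/-- Summing the compromised objectives over all agents recovers the global objective plus `λ`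
times the total assignment state, since `W` has zero diagonal and column sums one. -/
theorem sum_compromised {n : ℕ} {D : Fin n → Type*} [∀ i, Fintype (D i)]
    (E : ∀ _ : Fin n, (∀ j, D j) → ℝ) (W : Matrix (Fin n) (Fin n) ℝ)
    (hWdiag : ∀ j, W j j = 0) (hWcol : ∀ j, ∑ i, W i j = 1) (lam : ℝ)
    (Ψ : ∀ i, D i → ℝ) (x : ∀ j, D j) :
    ∑ i, compromised E W lam Ψ i x = ∑ i, E i x + lam * ∑ j, Ψ j (x j) := by
  have herase (i : Fin n) :
      ∑ j ∈ univ.erase i, W i j * Ψ j (x j) = ∑ j, W i j * Ψ j (x j) :=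
    sum_erase _ (by rw [hWdiag, zero_mul])
  simp only [compromised, herase, sum_add_distrib, ← mul_sum]
  rw [sum_comm]
  simp only [← sum_mul, hWcol, one_mul]

/-- If `Ψ*` is an equilibrium of the cooperative-optimization iteration (with `W`
nonnegative, zero-diagonal, column-stochastic and `0 ≤ λ < 1`) and the profile `x̃`
is a consensus solution (it maximizes every agent's compromised objective), then `x̃`
globally maximizes the global objective `E(x) = ∑_i E_i(x)`. -/
theorem consensus_equilibrium_is_global_optimum
    {n : ℕ} {D : Fin n → Type*} [∀ i, Fintype (D i)] [∀ i, Nonempty (D i)]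
    (E : ∀ _ : Fin n, (∀ j, D j) → ℝ) (W : Matrix (Fin n) (Fin n) ℝ)
    (hW0 : ∀ i j, 0 ≤ W i j) (hWdiag : ∀ j, W j j = 0) (hWcol : ∀ j, ∑ i, W i j = 1)
    (lam : ℝ) (hlam0 : 0 ≤ lam) (hlam1 : lam < 1)
    (Ψstar : ∀ i, D i → ℝ)
    (hEq : ∀ i (a : D i),
      Ψstar i a = univ.sup' univ_nonempty (fun x : ∀ j, D j =>
        compromised E W lam Ψstar i (Function.update x i a)))
    (xt : ∀ j, D j)
    (hCons : ∀ i, ∀ x : ∀ j, D j,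
      compromised E W lam Ψstar i x ≤ compromised E W lam Ψstar i xt) :
    ∀ x : ∀ j, D j, ∑ i, E i x ≤ ∑ i, E i xt := by
  have hle (i : Fin n) (x : ∀ j, D j) :
      compromised E W lam Ψstar i x ≤ Ψstar i (x i) := by
    rw [hEq]
    exact le_sup'_of_le _ (mem_univ x) (by rw [Function.update_eq_self])
  have hmax (i : Fin n) (a : D i) : Ψstar i a ≤ compromised E W lam Ψstar i xt := by
    rw [hEq]
    exact sup'_le _ _ fun y _ => hCons i _
  intro x
  have hx := sum_le_sum fun i (_ : i ∈ univ) => hle i x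
  have hxt := sum_le_sum fun i (_ : i ∈ univ) => hmax i (xt i)
  have hΨ : ∑ i, Ψstar i (x i) ≤ ∑ i, Ψstar i (xt i) :=
    sum_le_sum fun i _ => (hmax i (x i)).trans (hle i xt)
  rw [sum_compromised E W hWdiag hWcol] at hx hxt
  linarith [mul_le_mul_of_nonneg_left hΨ (sub_nonneg.2 hlam1.le)]
end
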